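/- For all z₁, z₂, z₃ ∈ ℂ, the following Jacobian identities hold: (C₆, C₉, 𝔠₁₂) = (3/2)·(C₁₂² − C₆·C₁₈); (C₆, C₁₂, 𝔠₁₂) = 432·C₉·C₁₈; (C₉, C₁₂, 𝔠₁₂) = (3/2)·C₁₈·(C₆² − C₁₂). -/

import Mathlib

noncomputable section

/-- Hessian invariant C₆. -/
def C₆ : ℂ → ℂ → ℂ → ℂ := fun z₁ z₂ z₃ =>
  z₁^6 + z₂^6 + z₃^6 - 10*(z₁^3*z₂^3 + z₂^3*z₃^3 + z₃^3*z₁^3)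
/-- Hessian invariant C₉. -/
def C₉ : ℂ → ℂ → ℂ → ℂ := fun z₁ z₂ z₃ =>
  (z₁^3 - z₂^3)*(z₂^3 - z₃^3)*(z₃^3 - z₁^3)
/-- Hessian invariant C₁₂. -/
def C₁₂ : ℂ → ℂ → ℂ → ℂ := fun z₁ z₂ z₃ =>
  (z₁^3 + z₂^3 + z₃^3)*((z₁^3 + z₂^3 + z₃^3)^3 + 216*z₁^3*z₂^3*z₃^3)
/-- Hessian invariant 𝔠₁₂. -/
def 𝔠₁₂ : ℂ → ℂ → ℂ → ℂ := fun z₁ z₂ z₃ =>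
  z₁*z₂*z₃*(27*z₁^3*z₂^3*z₃^3 - (z₁^3 + z₂^3 + z₃^3)^3)
/-- Hessian invariant C₁₈. -/
def C₁₈ : ℂ → ℂ → ℂ → ℂ := fun z₁ z₂ z₃ =>
  (z₁^3 + z₂^3 + z₃^3)^6 - 540*z₁^3*z₂^3*z₃^3*(z₁^3 + z₂^3 + z₃^3)^3 - 5832*z₁^6*z₂^6*z₃^6

/-- Complex partial derivative in the first variable. -/
def pd₁ (F : ℂ → ℂ → ℂ → ℂ) (z₁ z₂ z₃ : ℂ) : ℂ := deriv (fun t => F t z₂ z₃) z₁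
/-- Complex partial derivative in the second variable. -/
def pd₂ (F : ℂ → ℂ → ℂ → ℂ) (z₁ z₂ z₃ : ℂ) : ℂ := deriv (fun t => F z₁ t z₃) z₂
/-- Complex partial derivative in the third variable. -/
def pd₃ (F : ℂ → ℂ → ℂ → ℂ) (z₁ z₂ z₃ : ℂ) : ℂ := deriv (fun t => F z₁ z₂ t) z₃

/-- Jacobian determinant of three functions of (z₁, z₂, z₃). -/
def jac (F G H : ℂ → ℂ → ℂ → ℂ) (z₁ z₂ z₃ : ℂ) : ℂ :=
  Matrix.det !![pd₁ F z₁ z₂ z₃, pd₂ F z₁ z₂ z₃, pd₃ F z₁ z₂ z₃;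
                pd₁ G z₁ z₂ z₃, pd₂ G z₁ z₂ z₃, pd₃ G z₁ z₂ z₃;
                pd₁ H z₁ z₂ z₃, pd₂ H z₁ z₂ z₃, pd₃ H z₁ z₂ z₃]

/-- A function invariant under cyclic permutation has its second partial derivative determined by
the first one. -/
lemma pd₂_eq_pd₁_of_cyclic {F : ℂ → ℂ → ℂ → ℂ} (hF : ∀ a b c, F a b c = F b c a) (a b c : ℂ) :
    pd₂ F a b c = pd₁ F b c a := by
  simp only [pd₁, pd₂, hF a]

/-- A function invariant under cyclic permutation has its third partial derivative determined by
the first one. -/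
lemma pd₃_eq_pd₁_of_cyclic {F : ℂ → ℂ → ℂ → ℂ} (hF : ∀ a b c, F a b c = F b c a) (a b c : ℂ) :
    pd₃ F a b c = pd₁ F c a b := by
  simp only [pd₁, pd₃, fun t => hF t a b]

lemma C₆_cyclic (a b c : ℂ) : C₆ a b c = C₆ b c a := by
  simp only [C₆]; ring

lemma C₉_cyclic (a b c : ℂ) : C₉ a b c = C₉ b c a := by
  simp only [C₉]; ring

lemma C₁₂_cyclic (a b c : ℂ) : C₁₂ a b c = C₁₂ b c a := by
  simp only [C₁₂]; ring

lemma 𝔠₁₂_cyclic (a b c : ℂ) : 𝔠₁₂ a b c = 𝔠₁₂ b c a := by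
  simp only [𝔠₁₂]; ring

lemma pd₁_C₆ (a b c : ℂ) : pd₁ C₆ a b c = 6 * a ^ 2 * (a ^ 3 - 5 * (b ^ 3 + c ^ 3)) := by
  have h := hasDerivAt_id' a
  refine HasDerivAt.deriv (((((h.fun_pow 6).add_const (b ^ 6)).add_const (c ^ 6)).fun_sub
    (((((h.fun_pow 3).mul_const (b ^ 3)).add_const (b ^ 3 * c ^ 3)).fun_add
      ((h.fun_pow 3).const_mul (c ^ 3))).const_mul 10)).congr_deriv ?_)
  norm_num
  ring

lemma pd₁_C₉ (a b c : ℂ) :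
    pd₁ C₉ a b c = 3 * a ^ 2 * (b ^ 3 - c ^ 3) * (b ^ 3 + c ^ 3 - 2 * a ^ 3) := by
  have h := (hasDerivAt_id' a).fun_pow 3
  refine HasDerivAt.deriv ((((h.sub_const (b ^ 3)).mul_const (b ^ 3 - c ^ 3)).fun_mul
    (h.const_sub (c ^ 3))).congr_deriv ?_)
  norm_num
  ring

lemma pd₁_C₁₂ (a b c : ℂ) :
    pd₁ C₁₂ a b c = 3 * a ^ 2 * (4 * (a ^ 3 + b ^ 3 + c ^ 3) ^ 3
      + 216 * b ^ 3 * c ^ 3 * (2 * a ^ 3 + b ^ 3 + c ^ 3)) := by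
  have h := (hasDerivAt_id' a).fun_pow 3
  have hs := (h.add_const (b ^ 3)).add_const (c ^ 3)
  refine HasDerivAt.deriv ((hs.fun_mul ((hs.fun_pow 3).fun_add
    (((h.const_mul 216).mul_const (b ^ 3)).mul_const (c ^ 3)))).congr_deriv ?_)
  norm_num
  ring

lemma pd₁_𝔠₁₂ (a b c : ℂ) :
    pd₁ 𝔠₁₂ a b c = b * c * (108 * a ^ 3 * b ^ 3 * c ^ 3
      - (a ^ 3 + b ^ 3 + c ^ 3) ^ 2 * (10 * a ^ 3 + b ^ 3 + c ^ 3)) := by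
  have h := (hasDerivAt_id' a).fun_pow 3
  have hs := (h.add_const (b ^ 3)).add_const (c ^ 3)
  refine HasDerivAt.deriv (((((hasDerivAt_id' a).mul_const b).mul_const c).fun_mul
    ((((h.const_mul 27).mul_const (b ^ 3)).mul_const (c ^ 3)).fun_sub
      (hs.fun_pow 3))).congr_deriv ?_)
  norm_num
  ring

theorem jacobian_identities_II (z₁ z₂ z₃ : ℂ) :
    jac C₆ C₉ 𝔠₁₂ z₁ z₂ z₃ = (3/2) * ((C₁₂ z₁ z₂ z₃)^2 - C₆ z₁ z₂ z₃ * C₁₈ z₁ z₂ z₃) ∧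
    jac C₆ C₁₂ 𝔠₁₂ z₁ z₂ z₃ = 432 * C₉ z₁ z₂ z₃ * C₁₈ z₁ z₂ z₃ ∧
    jac C₉ C₁₂ 𝔠₁₂ z₁ z₂ z₃
      = (3/2) * C₁₈ z₁ z₂ z₃ * ((C₆ z₁ z₂ z₃)^2 - C₁₂ z₁ z₂ z₃) := by
  simp only [jac, Matrix.det_fin_three, Matrix.of_apply, Matrix.cons_val, pd₂_eq_pd₁_of_cyclic C₆_cyclic,
    pd₂_eq_pd₁_of_cyclic C₉_cyclic, pd₂_eq_pd₁_of_cyclic C₁₂_cyclic,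
    pd₂_eq_pd₁_of_cyclic 𝔠₁₂_cyclic, pd₃_eq_pd₁_of_cyclic C₆_cyclic,
    pd₃_eq_pd₁_of_cyclic C₉_cyclic, pd₃_eq_pd₁_of_cyclic C₁₂_cyclic,
    pd₃_eq_pd₁_of_cyclic 𝔠₁₂_cyclic, pd₁_C₆, pd₁_C₉, pd₁_C₁₂, pd₁_𝔠₁₂, C₆, C₉, C₁₂, C₁₈]
  refine ⟨?_, ?_, ?_⟩ <;> ring
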